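/- The delivery scheme is complete and consistent: the image of the map (k,i,j) ↦ (C_k[i,j], R_k[i,j]), defined on [K] × {1,…,K−t} × {1,…,t+L}, is exactly the set {(u,p) ∈ [K]×[K] : V[p,u] = 0} of all missing (user, part) pairs. -/

import Mathlib

/-- Placement matrix: `Vmat K t p k = 1` iff `(k - p) mod K ∈ {0, …, t-1}`. -/
def Vmat (K t : ℕ) (p k : ℕ) : ℕ :=
  if 0 ≤ ((k : ℤ) - (p : ℤ)) % (K : ℤ) ∧ ((k : ℤ) - (p : ℤ)) % (K : ℤ) < (t : ℤ)
  then 1 else 0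

/-- Delivery prime matrix `C_1`. -/
def C1 (K t : ℕ) (i j : ℕ) : ℕ :=
  if j ≤ t then j
  else if j + i - 1 ≤ K then j + i - 1 else j + i - 1 - (K - t)

/-- Delivery prime matrix `R_1`. -/
def R1 (K t : ℕ) (i j : ℕ) : ℕ :=
  if j ≤ t then (if i ≤ K - 2 * t + j then t + i else i + 2 * t - K)
  else 1

/-- Round-`k` matrix `C_k`, entrywise circular increment of `C_1`. -/
def Cmat (K t : ℕ) (k i j : ℕ) : ℕ := ((C1 K t i j + k - 2) % K) + 1

/-- Round-`k` matrix `R_k`, entrywise circular increment of `R_1`. -/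
def Rmat (K t : ℕ) (k i j : ℕ) : ℕ := ((R1 K t i j + k - 2) % K) + 1

theorem C1_mem_Icc {K t L i j : ℕ} (hKtL : t + L ≤ K)
    (hi : i ∈ Finset.Icc 1 (K - t)) (hj : j ∈ Finset.Icc 1 (t + L)) :
    C1 K t i j ∈ Finset.Icc 1 K := by
  rw [Finset.mem_Icc] at *
  unfold C1
  split_ifs <;> omega

theorem R1_mem_Icc {K t L i j : ℕ} (htL : t ≤ L) (hKtL : t + L ≤ K)
    (hi : i ∈ Finset.Icc 1 (K - t)) (hj : j ∈ Finset.Icc 1 (t + L)) :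
    R1 K t i j ∈ Finset.Icc 1 K := by
  rw [Finset.mem_Icc] at *
  unfold R1
  split_ifs <;> omega

/-- The prime pair `(c, r) = (C_1[i,j], R_1[i,j])` satisfies `t ≤ (c - r) mod K`. -/
theorem C1_R1_gap {K t L i j : ℕ} (htL : t ≤ L) (hKtL : t + L ≤ K)
    (hi : i ∈ Finset.Icc 1 (K - t)) (hj : j ∈ Finset.Icc 1 (t + L)) :
    R1 K t i j + t ≤ C1 K t i j ∨
      C1 K t i j < R1 K t i j ∧ R1 K t i j + t ≤ C1 K t i j + K := by
  rw [Finset.mem_Icc] at *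
  unfold C1 R1
  split_ifs <;> omega

theorem Nat.mod_eq_self_or_sub {a K : ℕ} (h : a < 2 * K) :
    a < K ∧ a % K = a ∨ K ≤ a ∧ a % K = a - K := by
  rcases lt_or_ge a K with h' | h'
  · exact .inl ⟨h', Nat.mod_eq_of_lt h'⟩
  · exact .inr ⟨h', by rw [Nat.mod_eq_sub_mod h', Nat.mod_eq_of_lt (by omega)]⟩

theorem Int.sub_emod_eq_sub_or_add {u p K : ℕ}
    (hu : u ∈ Finset.Icc 1 K) (hp : p ∈ Finset.Icc 1 K) :
    p ≤ u ∧ ((u : ℤ) - p) % K = u - p ∨ u < p ∧ ((u : ℤ) - p) % K = u - p + K := by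
  rw [Finset.mem_Icc] at *
  rcases le_or_gt p u with h | h
  · exact .inl ⟨h, Int.emod_eq_of_lt (by omega) (by omega)⟩
  · refine .inr ⟨h, ?_⟩
    rw [← Int.add_emod_right, Int.emod_eq_of_lt (by omega) (by omega)]

/-- User `u` misses part `p` iff `t ≤ (u - p) mod K`. -/
theorem Vmat_eq_zero_iff {K t u p : ℕ}
    (hu : u ∈ Finset.Icc 1 K) (hp : p ∈ Finset.Icc 1 K) :
    Vmat K t p u = 0 ↔ p + t ≤ u ∨ u < p ∧ p + t ≤ u + K := by
  have h := Int.sub_emod_eq_sub_or_add hu hp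
  rw [Finset.mem_Icc] at *
  unfold Vmat
  split_ifs
  · rw [false_iff]
    omega
  · rw [iff_true_left rfl]
    omega

theorem stmt_15 (K t L : ℕ) (hK : 0 < K) (ht : 0 < t) (hL : 0 < L)
    (htL : t ≤ L) (hKtL : t + L ≤ K) :
    ((Finset.Icc 1 K ×ˢ Finset.Icc 1 (K - t) ×ˢ Finset.Icc 1 (t + L)).image
      (fun x => (Cmat K t x.1 x.2.1 x.2.2, Rmat K t x.1 x.2.1 x.2.2)))
    = (Finset.Icc 1 K ×ˢ Finset.Icc 1 K).filter (fun up => Vmat K t up.2 up.1 = 0) := by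
  ext ⟨u, p⟩
  simp only [Finset.mem_image, Finset.mem_filter, Finset.mem_product, Prod.exists, Prod.mk.injEq]
  constructor
  · rintro ⟨k, i, j, ⟨hk, hi, hj⟩, rfl, rfl⟩
    have hC := C1_mem_Icc hKtL hi hj
    have hR := R1_mem_Icc htL hKtL hi hj
    have hgap := C1_R1_gap htL hKtL hi hj
    have hCm : Cmat K t k i j ∈ Finset.Icc 1 K :=
      Finset.mem_Icc.2 ⟨Nat.succ_pos _, Nat.mod_lt _ hK⟩
    have hRm : Rmat K t k i j ∈ Finset.Icc 1 K :=
      Finset.mem_Icc.2 ⟨Nat.succ_pos _, Nat.mod_lt _ hK⟩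
    refine ⟨⟨hCm, hRm⟩, (Vmat_eq_zero_iff hCm hRm).2 ?_⟩
    rw [Finset.mem_Icc] at hk hC hR
    have hCmod := Nat.mod_eq_self_or_sub (a := C1 K t i j + k - 2) (K := K) (by omega)
    have hRmod := Nat.mod_eq_self_or_sub (a := R1 K t i j + k - 2) (K := K) (by omega)
    unfold Cmat Rmat
    omega
  · rintro ⟨⟨hu, hp⟩, hV⟩
    have hgap := (Vmat_eq_zero_iff hu hp).1 hV
    simp only [Finset.mem_Icc] at *
    have key : ∃ i, 1 ≤ i ∧ i ≤ K - t ∧ (p + t + i = u + 1 ∨ p + t + i = u + K + 1) := by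
      rcases hgap with h | h
      · exact ⟨u + 1 - p - t, by omega⟩
      · exact ⟨u + K + 1 - p - t, by omega⟩
    obtain ⟨i, hi, hiK, hpi⟩ := key
    have hC : C1 K t i (t + 1) = t + i := by
      unfold C1
      split_ifs <;> omega
    have hR : R1 K t i (t + 1) = 1 := by
      unfold R1
      split_ifs <;> omega
    have hCmod := Nat.mod_eq_self_or_sub (a := t + i + p - 2) (K := K) (by omega)
    have hRmod := Nat.mod_eq_of_lt (a := 1 + p - 2) (b := K) (by omega)
    refine ⟨p, i, t + 1, by omega, ?_, ?_⟩
    · rw [Cmat, hC]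
      omega
    · rw [Rmat, hR]
      omega
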